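/- Let (x1,...,x6) with x2, x4, x6 > 0 satisfy the system (E): x1 = 2·x2·x4 − (1/2)·(x2/x4 + x4/x2), x3 = 2·x4·x6 − (1/2)·(x4/x6 + x6/x4), x5 = 2·x2·x6 − (1/2)·(x2/x6 + x6/x2), and suppose x3 ≥ 1, x5 ≥ 1, x1 > 1 and x1 = max{x1, x3, x5}. Then φ(x) ≤ max{ φ(x1,x1,x1,x1,x1,1/2), φ(x1,x1,x1,x1,1,1/2), φ(x1,x1,x1,1/2,x1,1/2), φ(x1,x1,x1,1/2,1,1/2) }, where φ(x) = (x3·x4 + x2·x5 + x1·x2·x3 + x1·x4·x5 + x6 − x1²·x6) / (√(x1² + x3² + x5² + 2·x1·x3·x5 − 1) · √(x2² + x4² + 2·x1·x2·x4)). -/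

import Mathlib

/-- The cosine of the dihedral angle at the hyper-ideal edge e23 of a decorated
3-1 type hyperbolic tetrahedron. -/
noncomputable def phi (x1 x2 x3 x4 x5 x6 : ℝ) : ℝ :=
  (x3 * x4 + x2 * x5 + x1 * x2 * x3 + x1 * x4 * x5 + x6 - x1 ^ 2 * x6) /
    (Real.sqrt (x1 ^ 2 + x3 ^ 2 + x5 ^ 2 + 2 * x1 * x3 * x5 - 1) *
      Real.sqrt (x2 ^ 2 + x4 ^ 2 + 2 * x1 * x2 * x4))

/-- With `y` fixed, comparing two of the right-hand sides of (E) compares `z` with `x`. -/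
theorem le_of_edge_le {x y z : ℝ} (hx : 0 < x) (hy : 0 < y) (hz : 0 < z)
    (hpos : 0 < 2 * x * y - (1/2) * (x / y + y / x))
    (h : 2 * y * z - (1/2) * (y / z + z / y) ≤ 2 * x * y - (1/2) * (x / y + y / x)) :
    z ≤ x := by
  by_contra! hlt
  have hc : 0 < 2 * y - 1 / (2 * y) := by
    have e : 2 * x * y - (1/2) * (x / y + y / x) =
        x * (2 * y - 1 / (2 * y)) - y / (2 * x) := by field_simp; ring
    have : 0 < y / (2 * x) := by positivity
    exact pos_of_mul_pos_right (by linarith : 0 < x * (2 * y - 1 / (2 * y))) hx.le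
  have hmul := mul_lt_mul_of_pos_right hlt hc
  have hdiv : y / z < y / x := div_lt_div_of_pos_left hy hx hlt
  have e : 2 * y * z - (1/2) * (y / z + z / y) - (2 * x * y - (1/2) * (x / y + y / x)) =
      z * (2 * y - 1 / (2 * y)) - x * (2 * y - 1 / (2 * y)) + (1/2) * (y / x - y / z) := by
    field_simp
    ring
  linarith

/-- The numerator of `phi` on solutions of the system (E). -/
theorem phi_num_eq {x y z a b c : ℝ} (hx : 0 < x) (hy : 0 < y) (hz : 0 < z)
    (ea : a = 2 * x * y - (1/2) * (x / y + y / x))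
    (eb : b = 2 * y * z - (1/2) * (y / z + z / y))
    (ec : c = 2 * x * z - (1/2) * (x / z + z / x)) :
    b * y + x * c + a * x * b + a * y * c + z - a ^ 2 * z =
      2 * x * y * (z * (4 * x * y - a - x * y / z ^ 2)) := by
  subst ea eb ec
  field_simp
  ring

/-- The first radicand of `phi` on solutions of the system (E). -/
theorem phi_radicand_eq {x y z a b c : ℝ} (hx : 0 < x) (hy : 0 < y) (hz : 0 < z)
    (ea : a = 2 * x * y - (1/2) * (x / y + y / x))
    (eb : b = 2 * y * z - (1/2) * (y / z + z / y))
    (ec : c = 2 * x * z - (1/2) * (x / z + z / x)) :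
    a ^ 2 + b ^ 2 + c ^ 2 + 2 * a * b * c - 1 =
      z ^ 2 * ((4 * x * y - a - x * y / z ^ 2) ^ 2 + 3 * (a ^ 2 - 1)) := by
  subst ea eb ec
  field_simp
  ring

/-- A solution of (E) whose largest component is `a = x1` satisfies
`phi ≤ √((1 + a) / (4 * a - 2))`, the value at the symmetric solution. -/
theorem phi_le_sqrt {x y z a b c : ℝ} (hx : 0 < x) (hy : 0 < y) (hz : 0 < z)
    (ea : a = 2 * x * y - (1/2) * (x / y + y / x))
    (eb : b = 2 * y * z - (1/2) * (y / z + z / y))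
    (ec : c = 2 * x * z - (1/2) * (x / z + z / x))
    (ha : 1 < a) (hb : b ≤ a) (hc : c ≤ a) :
    phi a x b y c z ≤ Real.sqrt ((1 + a) / (4 * a - 2)) := by
  have hzx : z ≤ x := le_of_edge_le hx hy hz (by linarith) (by linarith)
  have hzy : z ≤ y := by
    have e : 2 * y * x - (1/2) * (y / x + x / y) = a := by rw [ea]; ring
    exact le_of_edge_le hy hx hz (by linarith) (by linarith)
  have hT : 4 * x * y - a - x * y / z ^ 2 ≤ 1 + a := by
    have key : (x ^ 2 + y ^ 2 - x * y) * z ^ 2 ≤ (x * y) ^ 2 := by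
      rcases le_total x y with h | h
      · have h1 : x ^ 2 + y ^ 2 - x * y ≤ y ^ 2 := by nlinarith
        have h2 : z ^ 2 ≤ x ^ 2 := by gcongr
        nlinarith [mul_le_mul h1 h2 (sq_nonneg z) (sq_nonneg y)]
      · have h1 : x ^ 2 + y ^ 2 - x * y ≤ x ^ 2 := by nlinarith
        have h2 : z ^ 2 ≤ y ^ 2 := by gcongr
        nlinarith [mul_le_mul h1 h2 (sq_nonneg z) (sq_nonneg x)]
    have e : 1 + a - (4 * x * y - a - x * y / z ^ 2) =
        ((x * y) ^ 2 - (x ^ 2 + y ^ 2 - x * y) * z ^ 2) / (x * y * z ^ 2) := by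
      rw [ea]; field_simp; ring
    have : 0 ≤ ((x * y) ^ 2 - (x ^ 2 + y ^ 2 - x * y) * z ^ 2) / (x * y * z ^ 2) :=
      div_nonneg (by linarith) (by positivity)
    linarith
  have hD2 : x ^ 2 + y ^ 2 + 2 * a * x * y = (2 * x * y) ^ 2 := by
    rw [ea]; field_simp; ring
  unfold phi
  rw [phi_num_eq hx hy hz ea eb ec, phi_radicand_eq hx hy hz ea eb ec, hD2,
    Real.sqrt_sq (by positivity), Real.sqrt_mul (sq_nonneg z), Real.sqrt_sq hz.le]
  set T := 4 * x * y - a - x * y / z ^ 2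
  have hrad : 0 < T ^ 2 + 3 * (a ^ 2 - 1) := by nlinarith [sq_nonneg T]
  have hs := Real.sqrt_pos.mpr hrad
  rw [show 2 * x * y * (z * T) / (z * Real.sqrt (T ^ 2 + 3 * (a ^ 2 - 1)) * (2 * x * y)) =
    T / Real.sqrt (T ^ 2 + 3 * (a ^ 2 - 1)) by field_simp, div_le_iff₀ hs,
    ← Real.sqrt_mul (div_nonneg (by linarith) (by linarith))]
  rcases le_total T 0 with hT0 | hT0
  · exact hT0.trans (Real.sqrt_nonneg _)
  · apply Real.le_sqrt_of_sq_le
    rw [div_mul_eq_mul_div, le_div_iff₀ (by linarith)]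
    have h2 : T ^ 2 ≤ (1 + a) ^ 2 := by gcongr
    nlinarith [mul_le_mul_of_nonneg_left h2 (by linarith : 0 ≤ 3 * (a - 1))]

/-- The fourth extremal value dominates the value of `phi` at the symmetric solution. -/
theorem sqrt_le_phi {a : ℝ} (ha : 1 < a) :
    Real.sqrt ((1 + a) / (4 * a - 2)) ≤ phi a a a (1/2) 1 (1/2) := by
  unfold phi
  rw [show a ^ 2 + a ^ 2 + 1 ^ 2 + 2 * a * a * 1 - 1 = (2 * a) ^ 2 by ring,
    Real.sqrt_sq (by linarith), le_div_iff₀ (by positivity), mul_left_comm,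
    ← Real.sqrt_mul (div_nonneg (by linarith) (by linarith))]
  have hnum : 0 ≤ a * (1/2) + a * 1 + a * a * a + a * (1/2) * 1 + 1/2 - a ^ 2 * (1/2) := by
    nlinarith [mul_pos (sub_pos.mpr ha) (sub_pos.mpr ha)]
  refine le_of_sq_le_sq ?_ hnum
  rw [mul_pow, Real.sq_sqrt (mul_nonneg (div_nonneg (by linarith) (by linarith)) (by positivity)),
    div_mul_eq_mul_div, ← mul_div_assoc, div_le_iff₀ (by linarith)]
  obtain ⟨t, rfl⟩ : ∃ t, a = 1 + t := ⟨a - 1, by ring⟩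
  have ht : 0 < t := by linarith
  rw [← sub_nonneg]
  ring_nf
  positivity

/-- if x satisfies the system (E), x3, x5 ≥ 1, x1 > 1 and
x1 = max{x1,x3,x5}, then φ(x) is bounded above by the maximum of four extremal
values. -/
theorem stmt_12 (x1 x2 x3 x4 x5 x6 : ℝ)
    (h2 : 0 < x2) (h4 : 0 < x4) (h6 : 0 < x6)
    (e1 : x1 = 2 * x2 * x4 - (1/2) * (x2 / x4 + x4 / x2))
    (e3 : x3 = 2 * x4 * x6 - (1/2) * (x4 / x6 + x6 / x4))
    (e5 : x5 = 2 * x2 * x6 - (1/2) * (x2 / x6 + x6 / x2))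
    (h3 : 1 ≤ x3) (h5 : 1 ≤ x5) (h1 : 1 < x1)
    (hmax : x3 ≤ x1 ∧ x5 ≤ x1) :
    phi x1 x2 x3 x4 x5 x6 ≤
      max (max (phi x1 x1 x1 x1 x1 (1/2)) (phi x1 x1 x1 x1 1 (1/2)))
          (max (phi x1 x1 x1 (1/2) x1 (1/2)) (phi x1 x1 x1 (1/2) 1 (1/2))) :=
  ((phi_le_sqrt h2 h4 h6 e1 e3 e5 h1 hmax.1 hmax.2).trans (sqrt_le_phi h1)).trans
    ((le_max_right _ _).trans (le_max_right _ _))
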